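/- arXiv:2512.23839 — 3 statements merged into one kernel-verified Lean document; each statement's English description precedes it below -/
import Mathlib

section
/- Let a, m, α be integers with 1 ≤ a < m < α, let k be the smallest positive integer such that km − a ≥ α, and set q = mα + Σ_{i=1}^{α−1}(α+i). Then in ℬ[x] one has the identity (1+x^{m−a})(1+x^m)^{k−1}(1+x^α)^m ∏_{i=1}^{α−1}(1+x^{α+i}) = 1 + Σ_{i=0}^{k−1}(x^{im} + x^{(i+1)m−a}) + Σ_{j=α}^{q−α+km−a} x^j + Σ_{i=0}^{k−1}(x^{q+im} + x^{q+(i+1)m−a}). -/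
/-- The Boolean semifield `𝔹 = {0, 1}` with `1 + 1 = 1`
    (addition is `∨`, multiplication is `∧`). -/
def BoolSemiring : Type := Bool

namespace BoolSemiring

instance : Zero BoolSemiring := ⟨(false : Bool)⟩
instance : One BoolSemiring := ⟨(true : Bool)⟩
instance : Add BoolSemiring := ⟨fun a b => ((a : Bool) || (b : Bool) : Bool)⟩
instance : Mul BoolSemiring := ⟨fun a b => ((a : Bool) && (b : Bool) : Bool)⟩
instance : DecidableEq BoolSemiring := fun a b => instDecidableEqBool a b
instance : Fintype BoolSemiring := Bool.fintype

instance : CommSemiring BoolSemiring where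
  add_assoc := by decide
  zero_add := by decide
  add_zero := by decide
  add_comm := by decide
  mul_assoc := by decide
  one_mul := by decide
  mul_one := by decide
  zero_mul := by decide
  mul_zero := by decide
  left_distrib := by decide
  right_distrib := by decide
  mul_comm := by decide
  nsmul := nsmulRec

end BoolSemiring

notation "𝔹" => BoolSemiring

open Polynomial

namespace BoolSemiring

theorem add_ne_zero_iff (a b : 𝔹) : a + b ≠ 0 ↔ a ≠ 0 ∨ b ≠ 0 := by
  revert a b; decide

instance : Nontrivial 𝔹 := ⟨⟨0, 1, by decide⟩⟩

theorem add_self_polynomial (p : Polynomial 𝔹) : p + p = p := by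
  ext n
  rw [coeff_add]
  generalize p.coeff n = c
  revert c
  decide

/-- Polynomials over `𝔹` are determined by their supports. -/
theorem polynomial_ext {p r : Polynomial 𝔹} (h : ∀ n, p.coeff n ≠ 0 ↔ r.coeff n ≠ 0) : p = r := by
  ext n
  have h' := h n
  generalize p.coeff n = c, r.coeff n = d at h'
  revert c d
  decide

theorem coeff_add_ne_zero (p r : Polynomial 𝔹) (n : ℕ) :
    (p + r).coeff n ≠ 0 ↔ p.coeff n ≠ 0 ∨ r.coeff n ≠ 0 := by
  rw [coeff_add, add_ne_zero_iff]

theorem coeff_X_pow_ne_zero (c n : ℕ) : (X ^ c : Polynomial 𝔹).coeff n ≠ 0 ↔ n = c := by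
  simp [coeff_X_pow]

theorem coeff_one_ne_zero (n : ℕ) : (1 : Polynomial 𝔹).coeff n ≠ 0 ↔ n = 0 := by
  simp [coeff_one]

theorem coeff_X_pow_mul_ne_zero (p : Polynomial 𝔹) (c n : ℕ) :
    (X ^ c * p).coeff n ≠ 0 ↔ c ≤ n ∧ p.coeff (n - c) ≠ 0 := by
  simp [coeff_X_pow_mul']

theorem coeff_sum_ne_zero {ι : Type*} (s : Finset ι) (f : ι → Polynomial 𝔹) (n : ℕ) :
    (∑ i ∈ s, f i).coeff n ≠ 0 ↔ ∃ i ∈ s, (f i).coeff n ≠ 0 := by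
  classical
  induction s using Finset.induction_on with
  | empty => simp
  | insert a s ha ih =>
    rw [Finset.sum_insert ha, coeff_add_ne_zero, ih]
    simp

theorem coeff_sum_Icc_X_pow_ne_zero (u v n : ℕ) :
    (∑ j ∈ Finset.Icc u v, (X : Polynomial 𝔹) ^ j).coeff n ≠ 0 ↔ u ≤ n ∧ n ≤ v := by
  rw [coeff_sum_ne_zero]
  simp only [coeff_X_pow_ne_zero, Finset.mem_Icc]
  constructor
  · rintro ⟨i, hi, rfl⟩
    exact hi
  · exact fun h => ⟨n, h, rfl⟩

theorem coeff_prod_one_add_X_pow_ne_zero {ι : Type*} (s : Finset ι) (c : ι → ℕ) (n : ℕ) :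
    (∏ i ∈ s, ((1 : Polynomial 𝔹) + X ^ c i)).coeff n ≠ 0 ↔ ∃ t ⊆ s, ∑ i ∈ t, c i = n := by
  classical
  rw [Finset.prod_one_add, coeff_sum_ne_zero]
  simp only [Finset.prod_pow_eq_pow_sum, coeff_X_pow_ne_zero, Finset.mem_powerset, eq_comm]

theorem one_add_pow_eq_sum (y : Polynomial 𝔹) (n : ℕ) :
    (1 + y) ^ n = ∑ i ∈ Finset.range (n + 1), y ^ i := by
  induction n with
  | zero => simp
  | succ n ih =>
    have h : ∑ i ∈ Finset.range (n + 1), y ^ i + (∑ i ∈ Finset.range (n + 1), y ^ i) * y =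
        ∑ i ∈ Finset.range n, y ^ (i + 1) + ∑ i ∈ Finset.range n, y ^ (i + 1)
          + 1 + y ^ (n + 1) := by
      rw [Finset.sum_mul]
      simp only [← pow_succ]
      rw [Finset.sum_range_succ (fun i => y ^ (i + 1)), Finset.sum_range_succ']
      ring
    rw [pow_succ, ih, mul_add, mul_one, h, add_self_polynomial, Finset.sum_range_succ',
      Finset.sum_range_succ]
    ring

end BoolSemiring

open BoolSemiring

/-- The sums of the `j`-element subsets of `{0, …, j + d - 1}` fill an interval. -/
theorem exists_subset_range_card_eq_sum_eq (n : ℕ) : ∀ j d s : ℕ, j + d = n →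
    ∑ i ∈ Finset.range j, i ≤ s → s ≤ ∑ i ∈ Finset.range j, i + j * d →
    ∃ t ⊆ Finset.range n, t.card = j ∧ ∑ i ∈ t, i = s := by
  induction n with
  | zero =>
    intro j d s h h1 h2
    obtain ⟨rfl, rfl⟩ : j = 0 ∧ d = 0 := by omega
    exact ⟨∅, by simp, by simp, by simp at h2; simp [h2]⟩
  | succ n ih =>
    intro j d s h h1 h2
    rcases j with _ | j
    · exact ⟨∅, by simp, by simp, by simp at h2; simp [h2]⟩
    by_cases hd : 0 < d ∧ s ≤ ∑ i ∈ Finset.range (j + 1), i + (j + 1) * (d - 1)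
    · obtain ⟨t, ht, hc, hs⟩ := ih (j + 1) (d - 1) s (by omega) h1 hd.2
      exact ⟨t, ht.trans (Finset.range_mono (by omega)), hc, hs⟩
    rw [Finset.sum_range_succ] at h1 h2 hd
    have hn : n = j + d := by omega
    have hlow : ∑ i ∈ Finset.range j, i + n ≤ s := by
      rcases d with _ | d
      · omega
      · have : ∑ i ∈ Finset.range j, i + j + (j + 1) * d < s := by simpa using hd
        nlinarith [Nat.zero_le (j * d)]
    obtain ⟨t, ht, hc, hs⟩ := ih j d (s - n) hn.symm (by omega) (by
      have : (j + 1) * d = j * d + d := by ring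
      omega)
    have hnt : n ∉ t := fun h => by simpa using ht h
    refine ⟨insert n t, ?_, by rw [Finset.card_insert_of_notMem hnt, hc], ?_⟩
    · rw [Finset.range_add_one]
      exact Finset.insert_subset_insert _ ht
    · rw [Finset.sum_insert hnt, hs]
      omega

theorem exists_subset_range_sum_add_eq (α j s : ℕ) (hj : j ≤ α)
    (h1 : j * α + ∑ i ∈ Finset.range j, i ≤ s)
    (h2 : s ≤ j * α + ∑ i ∈ Finset.range j, i + j * (α - j)) :
    ∃ t ⊆ Finset.range α, ∑ i ∈ t, (α + i) = s := by
  obtain ⟨t, ht, hc, hs⟩ := exists_subset_range_card_eq_sum_eq α j (α - j) (s - j * α)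
    (by omega) (by omega) (by omega)
  refine ⟨t, ht, ?_⟩
  rw [Finset.sum_add_distrib, hs, Finset.sum_const, hc, smul_eq_mul]
  omega

theorem exists_subset_range_sum_add_eq_or (α j s : ℕ) (hj : j < α) (hs : α ≤ s)
    (h2 : s ≤ (j + 1) * α + ∑ i ∈ Finset.range (j + 1), i) :
    ∃ t ⊆ Finset.range α, ∑ i ∈ t, (α + i) = s ∨ ∑ i ∈ t, (α + i) + α = s := by
  induction j with
  | zero =>
    obtain ⟨t, ht, h⟩ := exists_subset_range_sum_add_eq α 1 s (by omega) (by simpa using hs)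
      (by simp at h2 ⊢; omega)
    exact ⟨t, ht, Or.inl h⟩
  | succ j ih =>
    by_cases hle : s ≤ (j + 1) * α + ∑ i ∈ Finset.range (j + 1), i
    · exact ih (by omega) hle
    rw [Finset.sum_range_succ] at h2
    obtain ⟨d, rfl⟩ : ∃ d, α = j + 1 + (d + 1) := ⟨α - (j + 1) - 1, by omega⟩
    by_cases hle' : s ≤ (j + 1) * (j + 1 + (d + 1)) + ∑ i ∈ Finset.range (j + 1), i
        + (j + 1) * (d + 1)
    · obtain ⟨t, ht, h⟩ := exists_subset_range_sum_add_eq (j + 1 + (d + 1)) (j + 1) s (by omega)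
        (by omega) (by simpa using hle')
      exact ⟨t, ht, Or.inl h⟩
    · obtain ⟨t, ht, h⟩ := exists_subset_range_sum_add_eq (j + 1 + (d + 1)) (j + 1)
        (s - (j + 1 + (d + 1))) (by omega)
        (by
          have : (j + 1) * (d + 1) = j * d + j + d + 1 := by ring
          have := Nat.zero_le (j * d)
          omega)
        (by
          simp only [Nat.add_sub_cancel_left]
          have : (j + 1) * (d + 1) = j * d + j + d + 1 := by ring
          have := Nat.zero_le (j * d)
          have : (j + 1 + 1) * (j + 1 + (d + 1)) =
            (j + 1) * (j + 1 + (d + 1)) + (j + 1 + (d + 1)) := by ring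
          omega)
      exact ⟨t, ht, Or.inr (by omega)⟩

theorem eq_zero_or_eq_or_le_of_subset_range {α n : ℕ} {t : Finset ℕ} (ht : t ⊆ Finset.range α)
    (hn : ∑ i ∈ t, (α + i) = n) :
    n = 0 ∨ n = ∑ i ∈ Finset.range α, (α + i) ∨
      α ≤ n ∧ n + α ≤ ∑ i ∈ Finset.range α, (α + i) := by
  have key : ∀ u : Finset ℕ, u = ∅ ∨ α ≤ ∑ i ∈ u, (α + i) := fun u => by
    rcases u.eq_empty_or_nonempty with h | ⟨x, hx⟩
    · exact Or.inl h
    · have := Finset.single_le_sum (f := fun i => α + i) (fun _ _ => Nat.zero_le _) hx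
      exact Or.inr (by omega)
  have hsum := Finset.sum_sdiff (f := fun i => α + i) ht
  rcases key t with rfl | h1
  · simp at hn
    omega
  rcases key (Finset.range α \ t) with h | h2
  · rw [h] at hsum
    simp only [Finset.sum_empty] at hsum
    omega
  · omega

theorem one_add_X_pow_mul_prod_range (α : ℕ) (hα : 0 < α) (m : ℕ) :
    ((1 : Polynomial 𝔹) + X ^ α) ^ (m + 1) *
        ∏ i ∈ Finset.range α, ((1 : Polynomial 𝔹) + X ^ (α + i)) =
      1 + ∑ j ∈ Finset.Icc α (m * α + ∑ i ∈ Finset.range α, (α + i)), (X : Polynomial 𝔹) ^ j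
        + X ^ ((m + 1) * α + ∑ i ∈ Finset.range α, (α + i)) := by
  set S := ∑ i ∈ Finset.range α, (α + i) with hS
  have hSα : S = α * α + ∑ i ∈ Finset.range α, i := by
    rw [hS, Finset.sum_add_distrib, Finset.sum_const, Finset.card_range, smul_eq_mul]
  have hαS : α * α ≤ S := by omega
  have hαα : α ≤ α * α := Nat.le_mul_self α
  induction m with
  | zero =>
    apply polynomial_ext
    intro n
    rw [zero_add, pow_one, add_mul, one_mul]
    simp only [coeff_add_ne_zero, coeff_X_pow_mul_ne_zero, coeff_prod_one_add_X_pow_ne_zero,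
      coeff_one_ne_zero, coeff_X_pow_ne_zero, coeff_sum_Icc_X_pow_ne_zero, zero_mul, zero_add,
      one_mul]
    constructor
    · rintro (⟨t, ht, h⟩ | ⟨hn, t, ht, h⟩)
      · have := eq_zero_or_eq_or_le_of_subset_range ht h
        omega
      · have := eq_zero_or_eq_or_le_of_subset_range ht h
        omega
    · rintro ((rfl | ⟨h1, h2⟩) | rfl)
      · exact Or.inl ⟨∅, by simp, by simp⟩
      · obtain ⟨t, ht, h⟩ := exists_subset_range_sum_add_eq_or α (α - 1) n (by omega) h1
          (by rw [Nat.sub_add_cancel hα]; omega)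
        rcases h with h | h
        · exact Or.inl ⟨t, ht, h⟩
        · exact Or.inr ⟨by omega, t, ht, by omega⟩
      · exact Or.inr ⟨by omega, _, subset_rfl, by omega⟩
  | succ m ih =>
    rw [pow_succ', mul_assoc, ih]
    apply polynomial_ext
    intro n
    rw [add_mul, one_mul]
    simp only [coeff_add_ne_zero, coeff_X_pow_mul_ne_zero,
      coeff_one_ne_zero, coeff_X_pow_ne_zero, coeff_sum_Icc_X_pow_ne_zero, add_mul, one_mul]
    have h0 := Nat.zero_le (m * α)
    by_cases h1 : α = 1
    · subst h1
      omega
    · have : 2 * α ≤ α * α := Nat.mul_le_mul_right α (by omega)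
      omega

theorem one_add_X_pow_mul_one_add_X_pow_pow {a m k : ℕ} (ham : a ≤ m) (hk : 0 < k) :
    ((1 : Polynomial 𝔹) + X ^ (m - a)) * ((1 : Polynomial 𝔹) + X ^ m) ^ (k - 1) =
      ∑ i ∈ Finset.range k, ((X : Polynomial 𝔹) ^ (i * m) + X ^ ((i + 1) * m - a)) := by
  rw [one_add_pow_eq_sum, Nat.sub_add_cancel hk, Finset.mul_sum]
  refine Finset.sum_congr rfl fun i _ => ?_
  rw [add_mul, one_mul, ← pow_mul, ← pow_add, mul_comm m i]
  congr 2
  rw [add_mul]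
  omega

theorem sum_mul_sum_Icc_X_pow {a m k u v : ℕ} (ham : a < m) (hk : 0 < k) (huv : u + m ≤ v + 1) :
    (∑ i ∈ Finset.range k, ((X : Polynomial 𝔹) ^ (i * m) + X ^ ((i + 1) * m - a))) *
        ∑ j ∈ Finset.Icc u v, (X : Polynomial 𝔹) ^ j =
      ∑ j ∈ Finset.Icc u (v + k * m - a), (X : Polynomial 𝔹) ^ j := by
  apply polynomial_ext
  intro n
  rw [Finset.sum_mul]
  simp only [add_mul (X ^ _), coeff_sum_ne_zero (Finset.range k), coeff_add_ne_zero,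
    coeff_X_pow_mul_ne_zero, coeff_sum_Icc_X_pow_ne_zero, Finset.mem_range]
  constructor
  · rintro ⟨i, hi, h⟩
    have h1 : (i + 1) * m ≤ k * m := Nat.mul_le_mul_right m hi
    rw [add_mul] at h h1
    omega
  · rintro ⟨h1, h2⟩
    have hkm : (k - 1 + 1) * m = k * m := by rw [Nat.sub_add_cancel hk]
    rw [add_mul] at hkm
    by_cases hn : n ≤ v
    · exact ⟨0, hk, Or.inl (by simp; omega)⟩
    by_cases hn' : n ≤ v + (k - 1) * m
    · have hdm := Nat.div_add_mod (n - v - 1) m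
      have hlt := Nat.mod_lt (n - v - 1) (show 0 < m by omega)
      set i := (n - v - 1) / m
      have hi : i < k - 1 := by
        by_contra! hc
        have := Nat.mul_le_mul_right m hc
        rw [mul_comm i] at this
        omega
      refine ⟨i + 1, by omega, Or.inl ?_⟩
      rw [add_mul, mul_comm i]
      omega
    · refine ⟨k - 1, by omega, Or.inr ?_⟩
      rw [add_mul]
      omega

theorem stmt_6 (a m α k q : ℕ) (ha : 1 ≤ a) (ham : a < m) (hmα : m < α)
    (hk : 0 < k) (hk1 : α ≤ k * m - a)
    (hkmin : ∀ k' : ℕ, 0 < k' → α ≤ k' * m - a → k ≤ k')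
    (hq : q = m * α + ∑ i ∈ Finset.Icc 1 (α - 1), (α + i)) :
    ((1 : Polynomial 𝔹) + X ^ (m - a)) * ((1 : Polynomial 𝔹) + X ^ m) ^ (k - 1) *
        ((1 : Polynomial 𝔹) + X ^ α) ^ m *
        ∏ i ∈ Finset.Icc 1 (α - 1), ((1 : Polynomial 𝔹) + X ^ (α + i)) =
      1 + (∑ i ∈ Finset.range k,
            ((X : Polynomial 𝔹) ^ (i * m) + X ^ ((i + 1) * m - a)))
        + (∑ j ∈ Finset.Icc α (q - α + k * m - a), (X : Polynomial 𝔹) ^ j)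
        + (∑ i ∈ Finset.range k,
            ((X : Polynomial 𝔹) ^ (q + i * m) + X ^ (q + (i + 1) * m - a))) := by
  have hα : 0 < α := by omega
  have hS : ∑ i ∈ Finset.range α, (α + i) = α + ∑ i ∈ Finset.Icc 1 (α - 1), (α + i) := by
    rw [Finset.range_eq_Ico, Finset.sum_eq_sum_Ico_succ_bot hα, add_zero, zero_add,
      ← Finset.Ico_add_one_right_eq_Icc, Nat.sub_add_cancel (show 1 ≤ α from hα)]
  have hP : ∏ i ∈ Finset.range α, ((1 : Polynomial 𝔹) + X ^ (α + i)) =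
      (1 + X ^ α) * ∏ i ∈ Finset.Icc 1 (α - 1), ((1 : Polynomial 𝔹) + X ^ (α + i)) := by
    rw [Finset.range_eq_Ico, Finset.prod_eq_prod_Ico_succ_bot hα, add_zero, zero_add,
      ← Finset.Ico_add_one_right_eq_Icc, Nat.sub_add_cancel (show 1 ≤ α from hα)]
  obtain ⟨l, rfl⟩ : ∃ l, m = l + 1 + 1 := ⟨m - 2, by omega⟩
  have hfull := one_add_X_pow_mul_prod_range α hα l
  rw [hP, ← mul_assoc, ← pow_succ, hS,
    show (l + 1) * α + (α + ∑ i ∈ Finset.Icc 1 (α - 1), (α + i)) = q by rw [hq]; ring,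
    show l * α + (α + ∑ i ∈ Finset.Icc 1 (α - 1), (α + i)) = q - α by
      rw [hq, add_mul (l + 1), add_mul l]; omega] at hfull
  have hsq : α * α ≤ ∑ i ∈ Finset.range α, (α + i) := by
    rw [Finset.sum_add_distrib, Finset.sum_const, Finset.card_range, smul_eq_mul]
    omega
  have h3 : 3 * α ≤ α * α := Nat.mul_le_mul_right α (by omega)
  have hq' : α + (l + 1 + 1) ≤ q - α + 1 := by
    have : q = l * α + α + ∑ i ∈ Finset.range α, (α + i) := by rw [hq, hS]; ring
    have := Nat.zero_le (l * α)
    omega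
  rw [mul_assoc, hfull, one_add_X_pow_mul_one_add_X_pow_pow ham.le hk, mul_add, mul_add, mul_one,
    sum_mul_sum_Icc_X_pow ham hk hq']
  congr 1
  · congr 1
    obtain ⟨n, rfl⟩ : ∃ n, k = n + 1 := ⟨k - 1, by omega⟩
    rw [Finset.sum_range_succ', zero_mul, pow_zero]
    nth_rewrite 1 [← add_self_polynomial 1]
    ring
  · rw [Finset.sum_mul]
    refine Finset.sum_congr rfl fun i _ => ?_
    rw [add_mul, ← pow_add, ← pow_add, add_comm _ q, add_comm _ q, Nat.add_sub_assoc]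
    rw [add_mul]
    omega
end

section
/- Let J be a prime ideal of ℬ[x] with x ∉ J such that 𝔄_J = {a ≥ 1 : 1+x^a ∈ J} is finite and has more than one element. Then the set {1+x^a+x^q : q ≥ 1, a ∈ 𝔄_J, a > 1} is contained in J if and only if the set {1+x+x^m : m ≥ 1} is contained in J. -/
open Polynomial

/-- The set `𝔄_J = {a ≥ 1 : 1 + x^a ∈ J}` associated to an ideal `J` of `𝔹[x]`. -/
def AJ (J : Ideal (Polynomial 𝔹)) : Set ℕ :=
  {a : ℕ | 1 ≤ a ∧ (1 : Polynomial 𝔹) + X ^ a ∈ J}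

theorem BoolSemiring.polynomial_add_self (f : Polynomial 𝔹) : f + f = f := by
  have h : (1 : 𝔹) + 1 = 1 := by decide
  have h2 : (1 : Polynomial 𝔹) + 1 = 1 := by
    rw [← C_1, ← C_add, h]
  calc f + f = f * (1 + 1) := by ring
    _ = f := by rw [h2, mul_one]

theorem BoolSemiring.one_add_X_pow (n : ℕ) :
    ((1 : Polynomial 𝔹) + X) ^ n = ∑ i ∈ Finset.range (n + 1), X ^ i := by
  induction n with
  | zero => simp
  | succ n ih =>
    have h : ∑ i ∈ Finset.range (n + 1), (X : Polynomial 𝔹) ^ i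
        = ∑ i ∈ Finset.range n, X ^ (i + 1) + 1 := by
      rw [Finset.sum_range_succ', pow_zero]
    calc ((1 : Polynomial 𝔹) + X) ^ (n + 1)
        = ∑ i ∈ Finset.range (n + 1), X ^ i + X * ∑ i ∈ Finset.range (n + 1), X ^ i := by
          rw [pow_succ, ih]; ring
      _ = (∑ i ∈ Finset.range n, X ^ (i + 1) + 1)
            + (∑ i ∈ Finset.range n, X ^ (i + 1) + X ^ (n + 1)) := by
          rw [Finset.mul_sum, Finset.sum_range_succ (fun i => (X : Polynomial 𝔹) * X ^ i), h]
          simp only [← pow_succ']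
      _ = (∑ i ∈ Finset.range n, X ^ (i + 1) + ∑ i ∈ Finset.range n, X ^ (i + 1))
            + X ^ (n + 1) + 1 := by
          ac_rfl
      _ = ∑ i ∈ Finset.range (n + 1 + 1), X ^ i := by
          rw [BoolSemiring.polynomial_add_self, Finset.sum_range_succ', Finset.sum_range_succ,
            pow_zero]

theorem one_mem_AJ {J : Ideal (Polynomial 𝔹)} (hJ : J.IsPrime) {a : ℕ} (ha : a ∈ AJ J) :
    1 ∈ AJ J := by
  obtain ⟨ha1, haJ⟩ := ha
  refine ⟨le_rfl, ?_⟩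
  rw [pow_one]
  refine hJ.mem_of_pow_mem (a + a - 1) ?_
  rw [BoolSemiring.one_add_X_pow, Nat.sub_add_cancel (by omega), Finset.sum_range_add]
  have h : ∑ i ∈ Finset.range a, (X : Polynomial 𝔹) ^ i + ∑ i ∈ Finset.range a, X ^ (a + i)
      = (∑ i ∈ Finset.range a, X ^ i) * (1 + X ^ a) := by
    simp only [pow_add, ← Finset.mul_sum]
    ring
  rw [h]
  exact J.mul_mem_left _ haJ

/-- The trinomial `1 + x^a + x^q` lies in `J` because its product with `1 + x^(q+c) ∉ J` does. -/
theorem trinomial_mem {J : Ideal (Polynomial 𝔹)} (hJ : J.IsPrime) {a c q : ℕ}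
    (ha : a ∈ AJ J) (hc : 1 ≤ q + c) (hqc : q + c ∉ AJ J)
    (h₁ : (1 : Polynomial 𝔹) + X ^ c + X ^ (c + a) ∈ J)
    (h₂ : (1 : Polynomial 𝔹) + X ^ c + X ^ (c + q) ∈ J) :
    (1 : Polynomial 𝔹) + X ^ a + X ^ q ∈ J := by
  refine (hJ.mem_or_mem (y := 1 + X ^ (q + c)) ?_).resolve_right fun h => hqc ⟨hc, h⟩
  have key : ((1 : Polynomial 𝔹) + X ^ a + X ^ q) * (1 + X ^ (q + c))
      = (1 + X ^ a) + X ^ q * ((1 + X ^ c + X ^ (c + a)) + (1 + X ^ c + X ^ (c + q))) := by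
    calc ((1 : Polynomial 𝔹) + X ^ a + X ^ q) * (1 + X ^ (q + c))
        = (1 + X ^ a) + X ^ q * ((1 + X ^ c) + X ^ (c + a) + X ^ (c + q)) := by ring
      _ = (1 + X ^ a) + X ^ q * (((1 + X ^ c) + (1 + X ^ c)) + X ^ (c + a) + X ^ (c + q)) := by
          rw [BoolSemiring.polynomial_add_self]
      _ = _ := by ring
  rw [key]
  exact J.add_mem ha.2 (J.mul_mem_left _ (J.add_mem h₁ h₂))

theorem stmt_9 (J : Ideal (Polynomial 𝔹)) (hJ : J.IsPrime)
    (hx : (X : Polynomial 𝔹) ∉ J)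
    (hfin : (AJ J).Finite) (hcard : 1 < (AJ J).ncard) :
    (∀ a ∈ AJ J, 1 < a → ∀ q : ℕ, 1 ≤ q → (1 : Polynomial 𝔹) + X ^ a + X ^ q ∈ J) ↔
      (∀ m : ℕ, 1 ≤ m → (1 : Polynomial 𝔹) + X + X ^ m ∈ J) := by
  obtain ⟨u, v, hu, hv, huv⟩ := (Set.one_lt_ncard_iff hfin).1 hcard
  obtain ⟨b, hb, hmax⟩ := Set.exists_max_image (AJ J) id hfin ⟨u, hu⟩
  simp only [id] at hmax
  have h_notMem : ∀ n, b < n → n ∉ AJ J := fun n hn h => (hmax n h).not_gt hn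
  have hb1 : 1 < b := by
    have := hmax u hu
    have := hmax v hv
    have := hu.1
    have := hv.1
    omega
  have h1 : 1 ∈ AJ J := one_mem_AJ hJ hu
  constructor
  · intro h m hm
    simpa using trinomial_mem hJ h1 (by omega) (h_notMem (m + b) (by omega))
      (h b hb hb1 _ (by omega)) (h b hb hb1 _ (by omega))
  · intro h
    have h_large : ∀ a ∈ AJ J, ∀ q, b ≤ q → (1 : Polynomial 𝔹) + X ^ a + X ^ q ∈ J := by
      intro a ha q hq
      refine trinomial_mem (c := 1) hJ ha (by omega) (h_notMem _ (by omega)) ?_ ?_ <;>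
        simpa using h _ (by omega)
    intro a ha _ q hq
    exact trinomial_mem hJ ha (by omega) (h_notMem (q + b) (by omega))
      (h_large b hb _ (by omega)) (h_large b hb _ (by omega))
end

section
/- Let n ≥ 1 and let ℬ[x₁,…,xₙ] be the multivariate polynomial semiring over ℬ. For a set 𝔄 of nonzero vectors in ℕⁿ, let I_𝔄 be the ideal of ℬ[x₁,…,xₙ] generated by {x₁,…,xₙ} ∪ {1+X^a : a ∈ 𝔄}, where X^a = x₁^{a₁}⋯xₙ^{aₙ}. Then: (1) I_𝔄 is a prime ideal if and only if 𝔄 is a prime subset of ℕⁿ; and (2) if P is any prime ideal of ℬ[x₁,…,xₙ] containing x₁,…,xₙ, then P = I_{𝔄_P}, where 𝔄_P = {a ∈ ℕⁿ : a ≠ 0 and 1+X^a ∈ P} is a prime subset of ℕⁿ. -/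
open Polynomial

/-- A set `𝔄` of nonzero exponent vectors in `ℕⁿ` is a *prime subset* if whenever
`a, b` are nonzero vectors with `a + b ∈ 𝔄`, then `a ∈ 𝔄` or `b ∈ 𝔄`. -/
def IsPrimeSubsetMv (n : ℕ) (𝔄 : Set (Fin n →₀ ℕ)) : Prop :=
  ∀ a b : Fin n →₀ ℕ, a ≠ 0 → b ≠ 0 → a + b ∈ 𝔄 → a ∈ 𝔄 ∨ b ∈ 𝔄

/-- The ideal `I_𝔄` of `𝔹[x₁,…,xₙ]` generated by `x₁,…,xₙ` and `{1 + X^a : a ∈ 𝔄}`. -/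
noncomputable def mvIdealOf (n : ℕ) (𝔄 : Set (Fin n →₀ ℕ)) :
    Ideal (MvPolynomial (Fin n) 𝔹) :=
  Ideal.span (Set.range (MvPolynomial.X : Fin n → MvPolynomial (Fin n) 𝔹) ∪
    ((fun a => (1 : MvPolynomial (Fin n) 𝔹) + MvPolynomial.monomial a 1) '' 𝔄))

namespace BoolSemiring

theorem eq_one_of_ne_zero : ∀ {x : 𝔹}, x ≠ 0 → x = 1 := by decide

theorem one_ne_zero' : (1 : 𝔹) ≠ 0 := by decide

theorem add_ne_zero_iff_s19 : ∀ {x y : 𝔹}, x + y ≠ 0 ↔ x ≠ 0 ∨ y ≠ 0 := by decide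

theorem mul_ne_zero_iff : ∀ {x y : 𝔹}, x * y ≠ 0 ↔ x ≠ 0 ∧ y ≠ 0 := by decide

theorem sum_ne_zero_iff {ι : Type*} {s : Finset ι} {f : ι → 𝔹} :
    ∑ i ∈ s, f i ≠ 0 ↔ ∃ i ∈ s, f i ≠ 0 := by
  classical
  refine ⟨Finset.exists_ne_zero_of_sum_ne_zero, ?_⟩
  rintro ⟨i, hi, h⟩
  rw [← Finset.add_sum_erase s f hi]
  exact add_ne_zero_iff_s19.2 (Or.inl h)

end BoolSemiring

namespace MvPolynomial

variable {σ : Type*}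

theorem coeff_mul_ne_zero_iff_bool {f g : MvPolynomial σ 𝔹} {a : σ →₀ ℕ} :
    coeff a (f * g) ≠ 0 ↔ ∃ b c, b + c = a ∧ coeff b f ≠ 0 ∧ coeff c g ≠ 0 := by
  classical
  rw [coeff_mul, BoolSemiring.sum_ne_zero_iff]
  simp only [Prod.exists, BoolSemiring.mul_ne_zero_iff]
  exact exists₂_congr fun b c => and_congr_left' Finset.HasAntidiagonal.mem_antidiagonal

theorem coeff_zero_mul_ne_zero_iff_bool {f g : MvPolynomial σ 𝔹} :
    coeff 0 (f * g) ≠ 0 ↔ coeff 0 f ≠ 0 ∧ coeff 0 g ≠ 0 := by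
  rw [coeff_mul_ne_zero_iff_bool]
  constructor
  · rintro ⟨b, c, h, hb, hc⟩
    obtain ⟨rfl, rfl⟩ := add_eq_zero.1 h
    exact ⟨hb, hc⟩
  · exact fun h => ⟨0, 0, add_zero 0, h⟩

theorem coeff_one_add_monomial_ne_zero_iff_bool {a b : σ →₀ ℕ} :
    coeff b (1 + monomial a (1 : 𝔹)) ≠ 0 ↔ b = 0 ∨ b = a := by
  classical
  rw [coeff_add, coeff_one, coeff_monomial, BoolSemiring.add_ne_zero_iff_s19]
  have := BoolSemiring.one_ne_zero'
  split_ifs <;> simp_all [eq_comm]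

theorem mem_of_coeff_zero_eq_zero {R : Type*} [CommSemiring R] {J : Ideal (MvPolynomial σ R)}
    (hJ : ∀ i, X i ∈ J) {f : MvPolynomial σ R} (hf : coeff 0 f = 0) : f ∈ J := by
  have hle : Ideal.span (X '' (Set.univ : Set σ)) ≤ J := by
    rw [Ideal.span_le]
    rintro _ ⟨i, -, rfl⟩
    exact hJ i
  refine hle (mem_ideal_span_X_image.2 fun m hm => ?_)
  by_contra! h
  have hm0 : m = 0 := Finsupp.ext fun i => h i (Set.mem_univ i)
  rw [hm0, mem_support_iff] at hm
  exact hm hf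

theorem monomial_mem_of_ne_zero {R : Type*} [CommSemiring R] {J : Ideal (MvPolynomial σ R)}
    (hJ : ∀ i, X i ∈ J) {a : σ →₀ ℕ} (ha : a ≠ 0) (r : R) : monomial a r ∈ J := by
  classical
  exact mem_of_coeff_zero_eq_zero hJ (by rw [coeff_monomial, if_neg ha])

theorem eq_one_add_sum_monomial_bool [DecidableEq σ] {f : MvPolynomial σ 𝔹}
    (hf : coeff 0 f ≠ 0) : f = 1 + ∑ a ∈ f.support.erase 0, monomial a 1 := by
  have hsum : f = ∑ a ∈ f.support, monomial a (1 : 𝔹) := by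
    conv_lhs => rw [f.as_sum]
    refine Finset.sum_congr rfl fun a ha => ?_
    rw [BoolSemiring.eq_one_of_ne_zero (mem_support_iff.1 ha)]
  conv_lhs => rw [hsum, ← Finset.add_sum_erase _ _ (mem_support_iff.2 hf)]
  rfl

theorem exists_one_add_monomial_mem {R : Type*} [CommSemiring R] {P : Ideal (MvPolynomial σ R)}
    (hP : P.IsPrime) (hX : ∀ i, X i ∈ P) (s : Finset (σ →₀ ℕ)) (hs : 0 ∉ s)
    (h : 1 + ∑ a ∈ s, monomial a (1 : R) ∈ P) : ∃ a ∈ s, 1 + monomial a (1 : R) ∈ P := by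
  classical
  induction s using Finset.induction_on with
  | empty =>
    rw [Finset.sum_empty, add_zero] at h
    exact absurd ((Ideal.eq_top_iff_one P).2 h) hP.ne_top
  | insert a s has ih =>
    rw [Finset.mem_insert, not_or] at hs
    have hmul : (1 + monomial a (1 : R)) * (1 + ∑ b ∈ s, monomial b 1) ∈ P := by
      have hexpand : (1 + monomial a (1 : R)) * (1 + ∑ b ∈ s, monomial b 1) =
          (1 + ∑ b ∈ insert a s, monomial b 1) + (∑ b ∈ s, monomial b 1) * monomial a 1 := by
        rw [Finset.sum_insert has]
        ring
      rw [hexpand]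
      exact P.add_mem h (P.mul_mem_left _ (monomial_mem_of_ne_zero hX (Ne.symm hs.1) 1))
    rcases hP.mem_or_mem hmul with h1 | h1
    · exact ⟨a, Finset.mem_insert_self a s, h1⟩
    · obtain ⟨b, hb, hbP⟩ := ih hs.2 h1
      exact ⟨b, Finset.mem_insert_of_mem hb, hbP⟩

end MvPolynomial

open MvPolynomial in
theorem X_mem_mvIdealOf {n : ℕ} (𝔄 : Set (Fin n →₀ ℕ)) (i : Fin n) :
    (X i : MvPolynomial (Fin n) 𝔹) ∈ mvIdealOf n 𝔄 :=
  Ideal.subset_span (Or.inl ⟨i, rfl⟩)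

open MvPolynomial in
theorem one_add_monomial_mem_mvIdealOf {n : ℕ} {𝔄 : Set (Fin n →₀ ℕ)} {a : Fin n →₀ ℕ}
    (ha : a ∈ 𝔄) : 1 + monomial a (1 : 𝔹) ∈ mvIdealOf n 𝔄 :=
  Ideal.subset_span (Or.inr ⟨a, ha, rfl⟩)

open MvPolynomial in
theorem mem_mvIdealOf_iff {n : ℕ} {𝔄 : Set (Fin n →₀ ℕ)} (h𝔄 : ∀ a ∈ 𝔄, a ≠ 0)
    {f : MvPolynomial (Fin n) 𝔹} :
    f ∈ mvIdealOf n 𝔄 ↔ (coeff 0 f ≠ 0 → ∃ a ∈ 𝔄, coeff a f ≠ 0) := by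
  classical
  constructor
  · intro hf
    induction hf using Submodule.span_induction with
    | mem f hf =>
      rcases hf with ⟨i, rfl⟩ | ⟨a, ha, rfl⟩
      · exact fun h => absurd (coeff_zero_X i) h
      · exact fun _ => ⟨a, ha, coeff_one_add_monomial_ne_zero_iff_bool.2 (Or.inr rfl)⟩
    | zero => exact fun h => absurd (MvPolynomial.coeff_zero 0) h
    | add f g _ _ hf hg =>
      simp only [MvPolynomial.coeff_add, BoolSemiring.add_ne_zero_iff_s19]
      rintro (h | h)
      · obtain ⟨a, ha, hfa⟩ := hf h
        exact ⟨a, ha, Or.inl hfa⟩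
      · obtain ⟨a, ha, hga⟩ := hg h
        exact ⟨a, ha, Or.inr hga⟩
    | smul g f _ hf =>
      rw [smul_eq_mul, coeff_zero_mul_ne_zero_iff_bool]
      rintro ⟨hg0, hf0⟩
      obtain ⟨a, ha, hfa⟩ := hf hf0
      exact ⟨a, ha, coeff_mul_ne_zero_iff_bool.2 ⟨0, a, zero_add a, hg0, hfa⟩⟩
  · intro h
    by_cases hf0 : coeff 0 f = 0
    · exact mem_of_coeff_zero_eq_zero (X_mem_mvIdealOf 𝔄) hf0
    · obtain ⟨a, ha, hfa⟩ := h hf0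
      have hmem : a ∈ f.support.erase 0 :=
        Finset.mem_erase.2 ⟨h𝔄 a ha, mem_support_iff.2 hfa⟩
      rw [eq_one_add_sum_monomial_bool hf0, ← Finset.add_sum_erase _ _ hmem, ← add_assoc]
      refine Ideal.add_mem _ (one_add_monomial_mem_mvIdealOf ha) (Ideal.sum_mem _ fun b hb => ?_)
      exact monomial_mem_of_ne_zero (X_mem_mvIdealOf 𝔄)
        (Finset.ne_of_mem_erase (Finset.mem_of_mem_erase hb)) 1

open MvPolynomial in
theorem one_add_monomial_mem_mvIdealOf_iff {n : ℕ} {𝔄 : Set (Fin n →₀ ℕ)}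
    (h𝔄 : ∀ a ∈ 𝔄, a ≠ 0) {a : Fin n →₀ ℕ} :
    1 + monomial a (1 : 𝔹) ∈ mvIdealOf n 𝔄 ↔ a ∈ 𝔄 := by
  refine ⟨fun h => ?_, one_add_monomial_mem_mvIdealOf⟩
  obtain ⟨b, hb, hcoeff⟩ := (mem_mvIdealOf_iff h𝔄).1 h
    (coeff_one_add_monomial_ne_zero_iff_bool.2 (Or.inl rfl))
  rcases coeff_one_add_monomial_ne_zero_iff_bool.1 hcoeff with rfl | rfl
  · exact absurd rfl (h𝔄 0 hb)
  · exact hb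

open MvPolynomial in
theorem isPrime_mvIdealOf_iff {n : ℕ} {𝔄 : Set (Fin n →₀ ℕ)} (h𝔄 : ∀ a ∈ 𝔄, a ≠ 0) :
    (mvIdealOf n 𝔄).IsPrime ↔ IsPrimeSubsetMv n 𝔄 := by
  constructor
  · intro hP a b ha hb hab
    rw [← one_add_monomial_mem_mvIdealOf_iff h𝔄, ← one_add_monomial_mem_mvIdealOf_iff h𝔄]
    refine hP.mem_or_mem ?_
    have hexpand : (1 + monomial a (1 : 𝔹)) * (1 + monomial b 1) =
        (1 + monomial (a + b) 1) + (monomial a 1 + monomial b 1) := by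
      rw [← mul_one (1 : 𝔹), ← monomial_mul, mul_one]
      ring
    rw [hexpand]
    exact Ideal.add_mem _ (one_add_monomial_mem_mvIdealOf hab)
      (Ideal.add_mem _ (monomial_mem_of_ne_zero (X_mem_mvIdealOf 𝔄) ha 1)
        (monomial_mem_of_ne_zero (X_mem_mvIdealOf 𝔄) hb 1))
  · intro hA
    refine ⟨fun htop => ?_, fun {f g} hfg => ?_⟩
    · have h1 := (Ideal.eq_top_iff_one _).1 htop
      rw [mem_mvIdealOf_iff h𝔄] at h1
      obtain ⟨a, ha, hcoeff⟩ := h1 (by rw [coeff_zero_one]; exact BoolSemiring.one_ne_zero')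
      rw [MvPolynomial.coeff_one, if_neg (Ne.symm (h𝔄 a ha))] at hcoeff
      exact hcoeff rfl
    · rw [mem_mvIdealOf_iff h𝔄, coeff_zero_mul_ne_zero_iff_bool] at hfg
      rw [mem_mvIdealOf_iff h𝔄, mem_mvIdealOf_iff h𝔄]
      by_contra! h
      obtain ⟨⟨hf0, hf⟩, hg0, hg⟩ := h
      obtain ⟨a, ha, hcoeff⟩ := hfg ⟨hf0, hg0⟩
      obtain ⟨b, c, rfl, hb, hc⟩ := coeff_mul_ne_zero_iff_bool.1 hcoeff
      have hbA : b ∉ 𝔄 := fun h => hb (hf b h)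
      have hcA : c ∉ 𝔄 := fun h => hc (hg c h)
      by_cases hb0 : b = 0
      · rw [hb0, zero_add] at ha
        exact hcA ha
      by_cases hc0 : c = 0
      · rw [hc0, add_zero] at ha
        exact hbA ha
      exact (hA b c hb0 hc0 ha).elim hbA hcA

open MvPolynomial in
theorem eq_mvIdealOf_of_isPrime {n : ℕ} {P : Ideal (MvPolynomial (Fin n) 𝔹)} (hP : P.IsPrime)
    (hX : ∀ i, X i ∈ P) :
    P = mvIdealOf n {a | a ≠ 0 ∧ 1 + monomial a (1 : 𝔹) ∈ P} := by
  classical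
  refine le_antisymm (fun f hf => ?_) (Ideal.span_le.2 ?_)
  · refine (mem_mvIdealOf_iff fun a ha => ha.1).2 fun hf0 => ?_
    rw [eq_one_add_sum_monomial_bool hf0] at hf
    obtain ⟨a, ha, haP⟩ := exists_one_add_monomial_mem hP hX _ (Finset.notMem_erase 0 _) hf
    obtain ⟨ha0, hsupp⟩ := Finset.mem_erase.1 ha
    exact ⟨a, ⟨ha0, haP⟩, mem_support_iff.1 hsupp⟩
  · rintro _ (⟨i, rfl⟩ | ⟨a, ha, rfl⟩)
    · exact hX i
    · exact ha.2

theorem stmt_19 (n : ℕ) (hn : 1 ≤ n)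
    (𝔄 : Set (Fin n →₀ ℕ)) (h𝔄 : ∀ a ∈ 𝔄, a ≠ 0) :
    ((mvIdealOf n 𝔄).IsPrime ↔ IsPrimeSubsetMv n 𝔄) ∧
    (∀ P : Ideal (MvPolynomial (Fin n) 𝔹), P.IsPrime →
      (∀ i : Fin n, (MvPolynomial.X i : MvPolynomial (Fin n) 𝔹) ∈ P) →
      IsPrimeSubsetMv n
        {a : Fin n →₀ ℕ | a ≠ 0 ∧ (1 : MvPolynomial (Fin n) 𝔹) + MvPolynomial.monomial a 1 ∈ P} ∧
      P = mvIdealOf n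
        {a : Fin n →₀ ℕ | a ≠ 0 ∧ (1 : MvPolynomial (Fin n) 𝔹) + MvPolynomial.monomial a 1 ∈ P}) := by
  refine ⟨isPrime_mvIdealOf_iff h𝔄, fun P hP hX => ?_⟩
  have hEq := eq_mvIdealOf_of_isPrime hP hX
  exact ⟨(isPrime_mvIdealOf_iff fun a ha => ha.1).1 (hEq ▸ hP), hEq⟩
end
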